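/- Let F be a field, d ≥ 2, and T = F⟨x₁,…,x_d⟩. There exists a homogeneous two-sided ideal I ⊆ T_{≥1} such that the finitely generated algebra A = T_{≥1}/I is nil and infinite-dimensional over F. -/

import Mathlib

/-- The degree-`n` homogeneous component of the free algebra `F⟨x₁,…,x_d⟩`. -/
noncomputable def freeAlgGrade (F : Type*) [Field F] (d : ℕ) (n : ℕ) :
    Submodule F (FreeAlgebra F (Fin d)) :=
  (Submodule.span F (Set.range (FreeAlgebra.ι F : Fin d → FreeAlgebra F (Fin d)))) ^ n

/-- The subspace of polynomials with zero constant term (degrees ≥ 1). -/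
noncomputable def freeAlgAug (F : Type*) [Field F] (d : ℕ) :
    Submodule F (FreeAlgebra F (Fin d)) :=
  ⨆ k : ℕ, freeAlgGrade F d (k + 1)

open Module

section GS

/-- Expansion of a power of a sum in a noncommutative algebra. -/
theorem gs_sum_pow {F T : Type*} [Field F] [Ring T] [Algebra F T] {m : ℕ}
    (x : Fin m → T) (c : Fin m → F) (N : ℕ) :
    (∑ i, c i • x i) ^ N =
      ∑ f : Fin N → Fin m, (∏ i, c (f i)) • (List.ofFn (fun i => x (f i))).prod := by
  induction N with
  | zero => simp
  | succ N ih =>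
    rw [pow_succ', ih, ← (Fin.consEquiv (fun _ => Fin m)).sum_comp, Fintype.sum_prod_type,
      Finset.sum_mul]
    refine Finset.sum_congr rfl fun i _ => ?_
    rw [Finset.mul_sum]
    refine Finset.sum_congr rfl fun f _ => ?_
    simp [Fin.consEquiv, Fin.prod_univ_succ, List.ofFn_succ, mul_smul]
    rw [smul_comm]

theorem gs_list_mem {F T : Type*} [Field F] [Ring T] [Algebra F T] {m : ℕ}
    (V : Submodule F T) (x : Fin m → T) (p : Fin m → ℕ) (hx : ∀ i, x i ∈ V ^ p i)
    (N : ℕ) (f : Fin N → Fin m) :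
    (List.ofFn (fun i => x (f i))).prod ∈ V ^ (∑ i, p (f i)) := by
  induction N with
  | zero => simpa using ⟨1, map_one _⟩
  | succ N ih =>
    rw [List.ofFn_succ, List.prod_cons, Fin.sum_univ_succ, pow_add]
    exact Submodule.mul_mem_mul (hx _) (ih _)

/-- The relations forcing `N`-th powers of combinations of `x` to vanish. -/
theorem gs_relations {F T : Type*} [Field F] [Ring T] [Algebra F T] {m : ℕ}
    (V : Submodule F T) (x : Fin m → T) (p : Fin m → ℕ) (hp : ∀ i, 1 ≤ p i)
    (hx : ∀ i, x i ∈ V ^ p i) (N : ℕ) :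
    ∃ (e : (Fin m → Fin (N + 1)) → T) (D : (Fin m → Fin (N + 1)) → ℕ),
      (∀ k, e k ∈ V ^ D k) ∧ (∀ k, N ≤ D k) ∧
      ∀ c : Fin m → F, (∑ i, c i • x i) ^ N ∈ Submodule.span F (Set.range e) := by
  classical
  let κ : (Fin N → Fin m) → (Fin m → Fin (N + 1)) := fun f b =>
    ⟨(Finset.univ.filter (fun a => f a = b)).card, by
      have := Finset.card_le_univ (Finset.univ.filter (fun a => f a = b))
      simp at this
      omega⟩
  refine ⟨fun k => ∑ f with κ f = k, (List.ofFn (fun i => x (f i))).prod,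
    fun k => max N (∑ b, (k b : ℕ) * p b), ?_, fun k => le_max_left _ _, ?_⟩
  · intro k
    refine Submodule.sum_mem _ fun f hf => ?_
    have hk : κ f = k := by simpa using hf
    have h1 : ∑ i, p (f i) = ∑ b, (k b : ℕ) * p b := by
      rw [← Finset.sum_fiberwise' Finset.univ f p, ← hk]
      simp [κ]
    have h2 : N ≤ ∑ i, p (f i) := by
      calc N = ∑ i : Fin N, 1 := by simp
        _ ≤ _ := Finset.sum_le_sum fun i _ => hp _
    have h3 := gs_list_mem V x p hx N f
    have h4 : max N (∑ b, (k b : ℕ) * p b) = ∑ i, p (f i) := by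
      rw [h1] at h2 ⊢; exact max_eq_right h2
    change _ ∈ V ^ (max N (∑ b, (k b : ℕ) * p b))
    rw [h4]
    exact h3
  · intro c
    rw [gs_sum_pow, ← Finset.sum_fiberwise Finset.univ κ]
    refine Submodule.sum_mem _ fun k _ => ?_
    have : ∑ f with κ f = k, (∏ i, c (f i)) • (List.ofFn (fun i => x (f i))).prod
        = (∏ b, c b ^ (k b : ℕ)) • ∑ f with κ f = k, (List.ofFn (fun i => x (f i))).prod := by
      rw [Finset.smul_sum]
      refine Finset.sum_congr rfl fun f hf => ?_
      have hk : κ f = k := by simpa using hf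
      congr 1
      rw [← Finset.prod_fiberwise' Finset.univ f c, ← hk]
      simp [κ]
    rw [this]
    exact Submodule.smul_mem _ _ (Submodule.subset_span ⟨k, rfl⟩)

variable (F : Type*) [Field F] (d : ℕ)

theorem gs_grade_eq_span (n : ℕ) : freeAlgGrade F d n =
    Submodule.span F (Set.range (fun l : List.Vector (Fin d) n =>
      (l.toList.map (FreeAlgebra.ι F)).prod)) := by
  induction n with
  | zero =>
    rw [freeAlgGrade, pow_zero, Submodule.one_eq_span]
    congr 1
    ext y
    constructor
    · rintro rfl
      exact ⟨List.Vector.nil, by simp⟩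
    · rintro ⟨l, rfl⟩
      rw [List.Vector.eq_nil l]; simp
  | succ n ih =>
    rw [freeAlgGrade] at ih ⊢
    rw [pow_succ', ih, Submodule.span_mul_span]
    congr 1
    ext y
    constructor
    · rintro ⟨_, ⟨i, rfl⟩, _, ⟨l, rfl⟩, rfl⟩
      exact ⟨i ::ᵥ l, by simp⟩
    · rintro ⟨l, rfl⟩
      exact ⟨_, ⟨l.head, rfl⟩, _, ⟨l.tail, rfl⟩, by
        have : l.toList = l.head :: l.tail.toList := by
          rw [← List.Vector.toList_cons, List.Vector.cons_head_tail]
        simp only [this, List.map_cons, List.prod_cons]⟩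

theorem gs_basis (l : List (Fin d)) :
    FreeAlgebra.basisFreeMonoid F (Fin d) (FreeMonoid.ofList l)
      = (l.map (FreeAlgebra.ι F)).prod := by
  simp [FreeAlgebra.basisFreeMonoid, FreeAlgebra.equivMonoidAlgebraFreeMonoid]

theorem gs_grade_finrank (n : ℕ) : finrank F (freeAlgGrade F d n) = d ^ n := by
  rw [gs_grade_eq_span, finrank_span_eq_card]
  · simp
  · have h := (FreeAlgebra.basisFreeMonoid F (Fin d)).linearIndependent.comp
      (fun l : List.Vector (Fin d) n => FreeMonoid.ofList l.toList) (by
        intro a b h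
        exact List.Vector.toList_injective (FreeMonoid.ofList.injective h))
    have h2 : (fun l : List.Vector (Fin d) n => (l.toList.map (FreeAlgebra.ι F)).prod) =
        (FreeAlgebra.basisFreeMonoid F (Fin d)) ∘
          (fun l : List.Vector (Fin d) n => FreeMonoid.ofList l.toList) := by
      ext l
      exact (gs_basis F d l.toList).symm
    rw [h2]
    exact h

instance gs_grade_fd (n : ℕ) : FiniteDimensional F (freeAlgGrade F d n) := by
  rw [gs_grade_eq_span]
  exact FiniteDimensional.span_of_finite F (Set.finite_range _)

theorem gs_iSup : (⨆ n, freeAlgGrade F d n) = ⊤ := by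
  rw [eq_top_iff, ← (FreeAlgebra.basisFreeMonoid F (Fin d)).span_eq, Submodule.span_le]
  rintro _ ⟨l, rfl⟩
  refine Submodule.mem_iSup_of_mem l.toList.length ?_
  rw [gs_grade_eq_span]
  exact Submodule.subset_span ⟨⟨l.toList, rfl⟩, (gs_basis F d l.toList).symm⟩

/-- Tagging of degrees. -/
noncomputable def gsTag : FreeAlgebra F (Fin d) →ₐ[F] Polynomial (FreeAlgebra F (Fin d)) :=
  FreeAlgebra.lift F (fun i => Polynomial.monomial 1 (FreeAlgebra.ι F i))

theorem gs_tag (n : ℕ) (t : FreeAlgebra F (Fin d)) (ht : t ∈ freeAlgGrade F d n) :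
    gsTag F d t = Polynomial.monomial n t := by
  induction ht using Submodule.pow_induction_on_left' with
  | algebraMap r => simp [Polynomial.algebraMap_apply]
  | add x y i hx hy h1 h2 => simp [h1, h2]
  | mem_mul m hm i x hx h =>
    have : gsTag F d m = Polynomial.monomial 1 m := by
      induction hm using Submodule.span_induction with
      | mem x h => obtain ⟨i, rfl⟩ := h; simp [gsTag]
      | zero => simp
      | add x y _ _ h1 h2 => simp [h1, h2]
      | smul a x _ h => rw [map_smul, h, Polynomial.smul_monomial]
    rw [map_mul, this, h, Polynomial.monomial_mul_monomial, Nat.succ_eq_one_add]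

theorem gs_mul_mem {m n : ℕ} {a b : FreeAlgebra F (Fin d)} (ha : a ∈ freeAlgGrade F d m)
    (hb : b ∈ freeAlgGrade F d n) : a * b ∈ freeAlgGrade F d (m + n) := by
  rw [freeAlgGrade, pow_add]; exact Submodule.mul_mem_mul ha hb

variable {F d}
variable {J : Type*} (s : J → FreeAlgebra F (Fin d)) (D : J → ℕ)

/-- Degree-`n` component of the ideal generated by the `s j`. -/
def gsJ (n : ℕ) : Submodule F (FreeAlgebra F (Fin d)) :=
  Submodule.span F {x | ∃ j p q a b, a ∈ freeAlgGrade F d p ∧ b ∈ freeAlgGrade F d q ∧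
    p + D j + q = n ∧ x = a * s j * b}

theorem gsJ_le (hs : ∀ j, s j ∈ freeAlgGrade F d (D j)) (n : ℕ) :
    gsJ s D n ≤ freeAlgGrade F d n := by
  refine Submodule.span_le.2 ?_
  rintro _ ⟨j, p, q, a, b, ha, hb, rfl, rfl⟩
  exact gs_mul_mem F d (gs_mul_mem F d ha (hs j)) hb

theorem gsJ_mul {m q : ℕ} {x b : FreeAlgebra F (Fin d)} (hx : x ∈ gsJ s D m)
    (hb : b ∈ freeAlgGrade F d q) : x * b ∈ gsJ s D (m + q) := by
  induction hx using Submodule.span_induction with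
  | mem x h =>
    obtain ⟨j, p, q', a, b', ha, hb', rfl, rfl⟩ := h
    exact Submodule.subset_span ⟨j, p, q' + q, a, b' * b, ha, gs_mul_mem F d hb' hb, by ring,
      by simp only [mul_assoc]⟩
  | zero => simp
  | add x y _ _ h1 h2 => rw [add_mul]; exact add_mem h1 h2
  | smul r x _ h => rw [smul_mul_assoc]; exact Submodule.smul_mem _ _ h

theorem gs_one_mem : (1 : FreeAlgebra F (Fin d)) ∈ freeAlgGrade F d 0 := by
  rw [freeAlgGrade, pow_zero]; exact Submodule.one_le.1 le_rfl

/-- `J n * V` -/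
noncomputable def gsR (n : ℕ) : Submodule F (FreeAlgebra F (Fin d)) :=
  Finset.univ.sup fun i : Fin d =>
    (gsJ s D n).map (LinearMap.mulRight F (FreeAlgebra.ι F i))

theorem gsR_mem {m q n : ℕ} (h : m + q = n) {x b : FreeAlgebra F (Fin d)} (hx : x ∈ gsJ s D m)
    (hb : b ∈ freeAlgGrade F d (q + 1)) : x * b ∈ gsR s D n := by
  rw [freeAlgGrade, pow_succ] at hb
  subst h
  induction hb using Submodule.mul_induction_on' with
  | mem_mul_mem u hu v hv =>
    rw [← mul_assoc]
    have h1 := gsJ_mul s D hx (b := u) (q := q) hu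
    induction hv using Submodule.span_induction with
    | mem v h =>
      obtain ⟨i, rfl⟩ := h
      exact Finset.le_sup (f := fun i : Fin d =>
        (gsJ s D (m + q)).map (LinearMap.mulRight F (FreeAlgebra.ι F i))) (Finset.mem_univ i)
        ⟨_, h1, rfl⟩
    | zero => simp
    | add x y _ _ h1 h2 => rw [mul_add]; exact add_mem h1 h2
    | smul r x _ h => rw [mul_smul_comm]; exact Submodule.smul_mem _ _ h
  | add x _ y _ h1 h2 => rw [mul_add]; exact add_mem h1 h2

theorem gsJ_step (hs : ∀ j, s j ∈ freeAlgGrade F d (D j)) (hD : ∀ j, 1 ≤ D j)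
    (B : ℕ → Submodule F (FreeAlgebra F (Fin d)))
    (hB : ∀ m, gsJ s D m ⊔ B m = freeAlgGrade F d m) (n : ℕ) (K : Finset J)
    (hK : ∀ j, D j ≤ n + 1 → j ∈ K) :
    gsJ s D (n + 1) ≤ gsR s D n ⊔
      K.sup fun j => (B (n + 1 - D j)).map (LinearMap.mulRight F (s j)) := by
  refine Submodule.span_le.2 ?_
  rintro _ ⟨j, p, q, a, b, ha, hb, hn, rfl⟩
  rcases q with _ | q
  · rw [freeAlgGrade, pow_zero] at hb
    obtain ⟨r, rfl⟩ := Submodule.mem_one.1 hb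
    rw [← Algebra.commutes, ← Algebra.smul_def]
    refine Submodule.smul_mem _ _ ?_
    rw [← hB p] at ha
    obtain ⟨y, hy, β, hβ, rfl⟩ := Submodule.mem_sup.1 ha
    rw [add_mul]
    refine Submodule.add_mem_sup ?_ ?_
    · obtain ⟨q', hq'⟩ := Nat.exists_eq_add_of_le' (hD j)
      have := hs j
      rw [hq'] at this
      exact gsR_mem s D (by omega) hy this
    · refine Finset.le_sup (f := fun j => (B (n + 1 - D j)).map (LinearMap.mulRight F (s j)))
        (hK j (by omega)) ⟨β, ?_, rfl⟩
      have : n + 1 - D j = p := by omega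
      rw [this]; exact hβ
  · refine Submodule.mem_sup_left ?_
    have h1 : a * s j ∈ gsJ s D (p + D j) :=
      Submodule.subset_span ⟨j, p, 0, a, 1, ha, gs_one_mem, rfl, by simp⟩
    exact gsR_mem s D (by omega) h1 hb

theorem gs_sup_finrank {E ι : Type*} [AddCommGroup E] [Module F E] (K : Finset ι)
    (f : ι → Submodule F E) (hf : ∀ i, FiniteDimensional F (f i)) :
    FiniteDimensional F (K.sup f : Submodule F E) ∧
    finrank F (K.sup f : Submodule F E) ≤ ∑ i ∈ K, finrank F (f i) := by
  classical
  induction K using Finset.induction_on with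
  | empty => rw [Finset.sup_empty]; exact ⟨inferInstance, by simp⟩
  | insert i K hi ih =>
    obtain ⟨h1, h2⟩ := ih
    have := hf i
    rw [Finset.sup_insert, Finset.sum_insert hi]
    exact ⟨inferInstance, (Submodule.finrank_add_le_finrank_add_finrank _ _).trans (by omega)⟩

theorem gsJ_fd (hs : ∀ j, s j ∈ freeAlgGrade F d (D j)) (n : ℕ) :
    FiniteDimensional F (gsJ s D n) :=
  Submodule.finiteDimensional_of_le (gsJ_le s D hs n)

theorem gs_exists_compl (hs : ∀ j, s j ∈ freeAlgGrade F d (D j)) (n : ℕ) :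
    ∃ B : Submodule F (FreeAlgebra F (Fin d)), gsJ s D n ⊔ B = freeAlgGrade F d n ∧
      FiniteDimensional F B ∧ finrank F (gsJ s D n) + finrank F B = d ^ n := by
  obtain ⟨C, hC⟩ := Submodule.exists_isCompl (gsJ s D n)
  have h1 : gsJ s D n ⊔ (C ⊓ freeAlgGrade F d n) = freeAlgGrade F d n := by
    rw [← sup_inf_assoc_of_le _ (gsJ_le s D hs n), hC.sup_eq_top, top_inf_eq]
  have h2 : FiniteDimensional F (C ⊓ freeAlgGrade F d n : Submodule F _) :=
    Submodule.finiteDimensional_of_le inf_le_right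
  have := gsJ_fd s D hs n
  refine ⟨_, h1, h2, ?_⟩
  rw [← Submodule.finrank_sup_add_finrank_inf_eq, h1, ← inf_assoc, hC.inf_eq_bot, bot_inf_eq,
    gs_grade_finrank]
  simp

/-- The Golod–Shafarevich growth argument. -/
theorem gs_growth (hd : 2 ≤ d) (hs : ∀ j, s j ∈ freeAlgGrade F d (D j)) (hD : ∀ j, 1 ≤ D j)
    (hfin : ∀ n, {j | D j ≤ n}.Finite)
    (hsum : ∀ K : Finset J, ∑ j ∈ K, (2 / 3 : ℝ) ^ (D j - 1) ≤ 1 / 2) (n : ℕ) :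
    ∃ t ∈ freeAlgGrade F d n, t ∉ gsJ s D n := by
  choose B hB hBf hBr using gs_exists_compl s D hs
  set a : ℕ → ℝ := fun n => (finrank F (B n) : ℝ) with ha
  have step : ∀ n, (2 : ℝ) * a n ≤ a (n + 1) + ∑ j ∈ (hfin (n + 1)).toFinset, a (n + 1 - D j) := by
    intro n
    have hJf := gsJ_fd s D hs n
    have h1 := gsJ_step s D hs hD B hB n (hfin (n + 1)).toFinset (by simp)
    obtain ⟨f2, e2⟩ := gs_sup_finrank (Finset.univ) (fun i : Fin d =>
      (gsJ s D n).map (LinearMap.mulRight F (FreeAlgebra.ι F i))) (fun i => inferInstance)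
    obtain ⟨f3, e3⟩ := gs_sup_finrank (hfin (n + 1)).toFinset (fun j =>
      (B (n + 1 - D j)).map (LinearMap.mulRight F (s j)))
      (fun j => by have := hBf (n + 1 - D j); infer_instance)
    change FiniteDimensional F (gsR s D n) at f2
    change finrank F (gsR s D n) ≤ _ at e2
    have h4 := (Submodule.finrank_mono h1).trans
      (Submodule.finrank_add_le_finrank_add_finrank _ _)
    have e2' : finrank F (gsR s D n) ≤ d * finrank F (gsJ s D n) := by
      refine e2.trans ((Finset.sum_le_sum fun i _ => Submodule.finrank_map_le _ _).trans ?_)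
      simp
    have e3' := e3.trans (Finset.sum_le_sum fun j _ => by
      have := hBf (n + 1 - D j)
      exact Submodule.finrank_map_le _ _)
    have r1 := hBr n
    have r2 := hBr (n + 1)
    have key : d * finrank F (B n) ≤ finrank F (B (n + 1)) +
        ∑ j ∈ (hfin (n + 1)).toFinset, finrank F (B (n + 1 - D j)) := by
      have : d * finrank F (gsJ s D n) + d * finrank F (B n) = d ^ (n + 1) := by
        rw [← mul_add, r1, pow_succ']
      omega
    have key2 : (2 : ℕ) * finrank F (B n) ≤ _ := (Nat.mul_le_mul_right _ hd).trans key
    simp only [ha]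
    exact_mod_cast key2
  have hnn : ∀ n, 0 ≤ a n := fun n => Nat.cast_nonneg _
  have grow : ∀ n, (∀ m k, m + k = n → a m ≤ (2 / 3 : ℝ) ^ k * a n) ∧ 0 < a n := by
    intro n
    induction n with
    | zero =>
      constructor
      · intro m k h
        obtain ⟨rfl, rfl⟩ : m = 0 ∧ k = 0 := by omega
        simp
      · have h0 : gsJ s D 0 = ⊥ := by
          rw [gsJ, Submodule.span_eq_bot]
          rintro x ⟨j, p, q, a, b, -, -, h, -⟩
          have := hD j
          omega
        have := hBr 0
        rw [h0] at this
        simp at this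
        simp [ha, this]
    | succ n ih =>
      obtain ⟨ih1, ih2⟩ := ih
      have h1 : ∑ j ∈ (hfin (n + 1)).toFinset, a (n + 1 - D j) ≤ 1 / 2 * a n := by
        refine le_trans ?_ (mul_le_mul_of_nonneg_right (hsum (hfin (n + 1)).toFinset) ih2.le)
        rw [Finset.sum_mul]
        refine Finset.sum_le_sum fun j hj => ih1 _ _ ?_
        have h2 : D j ≤ n + 1 := by simpa using hj
        have := hD j
        omega
      have h3 : 3 / 2 * a n ≤ a (n + 1) := by linarith [step n]
      refine ⟨fun m k h => ?_, by linarith⟩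
      rcases k with _ | k
      · obtain rfl : m = n + 1 := by omega
        simp
      · have := ih1 m k (by omega)
        have hp : (0 : ℝ) ≤ (2 / 3) ^ k := by positivity
        rw [pow_succ]
        nlinarith
  by_contra hcon
  push Not at hcon
  have h1 : gsJ s D n = freeAlgGrade F d n := le_antisymm (gsJ_le s D hs n) hcon
  have h2 := hBr n
  rw [h1, gs_grade_finrank] at h2
  have h3 := (grow n).2
  have h4 : finrank F (B n) = 0 := by omega
  simp [ha, h4] at h3

theorem gs_hom_decomp (a : FreeAlgebra F (Fin d)) (P : FreeAlgebra F (Fin d) → Prop)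
    (h : ∀ n, ∀ a ∈ freeAlgGrade F d n, P a) (h0 : P 0) (hadd : ∀ x y, P x → P y → P (x + y)) :
    P a := by
  have ha : a ∈ ⨆ n, freeAlgGrade F d n := by rw [gs_iSup]; trivial
  exact Submodule.iSup_induction (motive := P) _ ha h h0 hadd

theorem gs_coeff (hs : ∀ j, s j ∈ freeAlgGrade F d (D j)) (n : ℕ) (x : FreeAlgebra F (Fin d))
    (hx : x ∈ Submodule.span F {x | ∃ t ∈ Set.range s, ∃ a b, x = a * t * b}) :
    (gsTag F d x).coeff n ∈ gsJ s D n := by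
  induction hx using Submodule.span_induction with
  | mem x h =>
    obtain ⟨_, ⟨j, rfl⟩, a, b, rfl⟩ := h
    refine gs_hom_decomp a (fun a => (gsTag F d (a * s j * b)).coeff n ∈ gsJ s D n) ?_ (by simp)
      (fun x y h1 h2 => by simpa [add_mul] using add_mem h1 h2)
    intro p a ha
    refine gs_hom_decomp b (fun b => (gsTag F d (a * s j * b)).coeff n ∈ gsJ s D n) ?_ (by simp)
      (fun x y h1 h2 => by simpa [mul_add] using add_mem h1 h2)
    intro q b hb
    rw [gs_tag F d _ _ (gs_mul_mem F d (gs_mul_mem F d ha (hs j)) hb), Polynomial.coeff_monomial]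
    split_ifs with h
    · exact Submodule.subset_span ⟨j, p, q, a, b, ha, hb, h, rfl⟩
    · simp
  | zero => simp
  | add x y _ _ h1 h2 => simpa using add_mem h1 h2
  | smul r x _ h =>
    rw [map_smul, Polynomial.coeff_smul]
    exact Submodule.smul_mem _ _ h

theorem gs_le_aug (hs : ∀ j, s j ∈ freeAlgGrade F d (D j)) (hD : ∀ j, 1 ≤ D j) :
    Submodule.span F {x | ∃ t ∈ Set.range s, ∃ a b, x = a * t * b} ≤ freeAlgAug F d := by
  refine Submodule.span_le.2 ?_
  rintro _ ⟨_, ⟨j, rfl⟩, a, b, rfl⟩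
  refine gs_hom_decomp a (fun a => a * s j * b ∈ freeAlgAug F d) ?_ (by simp)
    (fun x y h1 h2 => by simpa [add_mul] using add_mem h1 h2)
  intro p a ha
  refine gs_hom_decomp b (fun b => a * s j * b ∈ freeAlgAug F d) ?_ (by simp)
    (fun x y h1 h2 => by simpa [mul_add] using add_mem h1 h2)
  intro q b hb
  have h := gs_mul_mem F d (gs_mul_mem F d ha (hs j)) hb
  refine Submodule.mem_iSup_of_mem (p + D j + q - 1) ?_
  have := hD j
  rwa [Nat.sub_add_cancel (by omega)]

theorem gs_not_finite (hs : ∀ j, s j ∈ freeAlgGrade F d (D j))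
    (ht : ∀ n, ∃ t ∈ freeAlgGrade F d n, t ∉ gsJ s D n)
    (I : Submodule F (FreeAlgebra F (Fin d)))
    (hI : I = Submodule.span F {x | ∃ t ∈ Set.range s, ∃ a b, x = a * t * b}) :
    ¬ Module.Finite F (↥(freeAlgAug F d) ⧸ (I.comap (freeAlgAug F d).subtype)) := by
  intro hfin
  choose t ht1 ht2 using ht
  let u : ℕ → freeAlgAug F d := fun n => ⟨t (n + 1), Submodule.mem_iSup_of_mem n (ht1 _)⟩
  have hli : LinearIndependent F (fun n => (I.comap (freeAlgAug F d).subtype).mkQ (u n)) := by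
    rw [linearIndependent_iff']
    intro K g hg m hm
    by_contra hgm
    simp only [← map_smul, ← map_sum] at hg
    rw [Submodule.mkQ_apply, Submodule.Quotient.mk_eq_zero, Submodule.mem_comap, hI] at hg
    have h := gs_coeff s D hs (m + 1) _ hg
    simp only [map_sum, map_smul, Submodule.subtype_apply, u, gs_tag F d _ _ (ht1 _),
      Polynomial.finsetSum_coeff, Polynomial.coeff_smul, Polynomial.coeff_monomial] at h
    rw [Finset.sum_eq_single m (fun b _ hb => by simp [hb]) (fun h => absurd hm h)] at h
    rw [if_pos rfl] at h
    exact ht2 (m + 1) ((Submodule.smul_mem_iff _ hgm).1 h)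
  have := hli.finite
  exact not_finite ℕ

theorem gs_numeric (m : ℕ) : ∃ N : ℕ, m + 1 ≤ N ∧
    ((N : ℝ) + 1) ^ m * (2 / 3 : ℝ) ^ (N - 1) ≤ (1 / 2) ^ (m + 2) := by
  have h := tendsto_pow_const_mul_const_pow_of_abs_lt_one m (r := 2 / 3)
    (by rw [abs_of_pos] <;> norm_num)
  have h1 := (h.eventually_le_const (u := 4 / 9 * (1 / 2 : ℝ) ^ (m + 2)) (by positivity)).and
    (Filter.eventually_ge_atTop (m + 2))
  obtain ⟨M, hM, hM2⟩ := h1.exists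
  obtain ⟨N, rfl⟩ : ∃ N, M = N + 2 := ⟨M - 2, by omega⟩
  refine ⟨N + 1, by omega, ?_⟩
  rw [pow_add (2 / 3 : ℝ)] at hM
  push_cast at hM ⊢
  rw [add_assoc (N : ℝ)]
  norm_num at hM ⊢
  linarith

theorem gs_enum (hd : 2 ≤ d) : ∃ (x : ℕ → FreeAlgebra F (Fin d)) (p : ℕ → ℕ),
    (∀ i, 1 ≤ p i) ∧ (∀ i, x i ∈ freeAlgGrade F d (p i)) ∧
    freeAlgAug F d ≤ Submodule.span F (Set.range x) := by
  have : Nonempty (Fin d × List (Fin d)) := ⟨(⟨0, by omega⟩, [])⟩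
  obtain ⟨u, hu⟩ := exists_surjective_nat (Fin d × List (Fin d))
  refine ⟨fun i => (((u i).1 :: (u i).2).map (FreeAlgebra.ι F)).prod,
    fun i => (u i).2.length + 1, fun i => by simp, fun i => ?_, ?_⟩
  · rw [gs_grade_eq_span]
    exact Submodule.subset_span ⟨⟨(u i).1 :: (u i).2, by simp⟩, rfl⟩
  · refine iSup_le fun k => ?_
    rw [gs_grade_eq_span, Submodule.span_le]
    rintro _ ⟨l, rfl⟩
    obtain ⟨i, hi⟩ := hu (l.head, l.tail.toList)
    refine Submodule.subset_span ⟨i, ?_⟩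
    have : l.toList = l.head :: l.tail.toList := by
      rw [← List.Vector.toList_cons, List.Vector.cons_head_tail]
    simp only [hi, this]

end GS

/-- The Golod–Shafarevich counterexample: a homogeneous two-sided ideal
`I ⊆ T_{≥1}` such that `T_{≥1}/I` is nil and infinite-dimensional. -/
theorem golod_shafarevich_counterexample
    (F : Type*) [Field F] (d : ℕ) (hd : 2 ≤ d) :
    ∃ (I : Submodule F (FreeAlgebra F (Fin d))) (S : Set (FreeAlgebra F (Fin d))),
      (∀ s ∈ S, ∃ n : ℕ, 1 ≤ n ∧ s ∈ freeAlgGrade F d n) ∧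
      I = Submodule.span F {x | ∃ s ∈ S, ∃ a b, x = a * s * b} ∧
      I ≤ freeAlgAug F d ∧
      (∀ g ∈ freeAlgAug F d, ∃ n : ℕ, 1 ≤ n ∧ g ^ n ∈ I) ∧
      ¬ Module.Finite F
          (↥(freeAlgAug F d) ⧸ (I.comap (freeAlgAug F d).subtype)) := by
  obtain ⟨x, p, hp, hx, hspan⟩ := gs_enum (F := F) hd
  choose N hN1 hN2 using gs_numeric
  have hrel := fun m : ℕ => gs_relations (m := m)
    (Submodule.span F (Set.range (FreeAlgebra.ι F : Fin d → FreeAlgebra F (Fin d))))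
    (fun i => x i) (fun i => p i) (fun i => hp i) (fun i => hx i) (N m)
  choose e E he hE hpow using hrel
  let s : (Σ m : ℕ, Fin m → Fin (N m + 1)) → FreeAlgebra F (Fin d) := fun j => e j.1 j.2
  let D : (Σ m : ℕ, Fin m → Fin (N m + 1)) → ℕ := fun j => E j.1 j.2
  have hs : ∀ j, s j ∈ freeAlgGrade F d (D j) := fun j => he j.1 j.2
  have hDN : ∀ j, N j.1 ≤ D j := fun j => hE j.1 j.2
  have hD : ∀ j, 1 ≤ D j := fun j => by
    have := hDN j
    have := hN1 j.1
    omega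
  have hfin : ∀ n, {j | D j ≤ n}.Finite := by
    intro n
    refine ((Finset.range n).sigma fun m =>
      (Finset.univ : Finset (Fin m → Fin (N m + 1)))).finite_toSet.subset ?_
    intro j hj
    have h1 : D j ≤ n := hj
    have := hDN j
    have := hN1 j.1
    simp
    omega
  have hgeom : ∀ M : ℕ, ∑ m ∈ Finset.range M, (1 / 2 : ℝ) ^ (m + 2) = 1 / 2 - (1 / 2) ^ (M + 1) := by
    intro M
    induction M with
    | zero => norm_num
    | succ M ih => rw [Finset.sum_range_succ, ih]; ring
  have hsum : ∀ K : Finset (Σ m : ℕ, Fin m → Fin (N m + 1)),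
      ∑ j ∈ K, (2 / 3 : ℝ) ^ (D j - 1) ≤ 1 / 2 := by
    intro K
    obtain ⟨M, hM⟩ : ∃ M : ℕ, ∀ j ∈ K, j.1 < M :=
      ⟨K.sup (fun j => j.1) + 1, fun j hj =>
        Nat.lt_succ_of_le (Finset.le_sup (f := fun j => j.1) hj)⟩
    calc ∑ j ∈ K, (2 / 3 : ℝ) ^ (D j - 1)
        ≤ ∑ j ∈ (Finset.range M).sigma fun m =>
            (Finset.univ : Finset (Fin m → Fin (N m + 1))), (2 / 3 : ℝ) ^ (D j - 1) := by
          refine Finset.sum_le_sum_of_subset_of_nonneg (fun j hj => ?_)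
            (fun _ _ _ => by positivity)
          simpa using hM j hj
      _ ≤ ∑ m ∈ Finset.range M, (1 / 2 : ℝ) ^ (m + 2) := by
          rw [Finset.sum_sigma]
          refine Finset.sum_le_sum fun m _ => le_trans ?_ (hN2 m)
          calc _ ≤ ∑ k : Fin m → Fin (N m + 1), (2 / 3 : ℝ) ^ (N m - 1) := by
                refine Finset.sum_le_sum fun k _ => ?_
                refine pow_le_pow_of_le_one (by norm_num) (by norm_num) ?_
                exact Nat.sub_le_sub_right (hE m k) 1
            _ = _ := by simp
      _ ≤ 1 / 2 := by
          rw [hgeom]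
          have : (0 : ℝ) < (1 / 2) ^ (M + 1) := by positivity
          linarith
  refine ⟨_, Set.range s, ?_, rfl, gs_le_aug s D hs hD, ?_,
    gs_not_finite s D hs (gs_growth s D hd hs hD hfin hsum) _ rfl⟩
  · rintro _ ⟨j, rfl⟩
    exact ⟨D j, hD j, hs j⟩
  · intro g hg
    obtain ⟨c, rfl⟩ := Finsupp.mem_span_range_iff_exists_finsupp.1 (hspan hg)
    obtain ⟨m, hm⟩ : ∃ m, c.support ⊆ Finset.range m :=
      ⟨c.support.sup id + 1, fun i hi => Finset.mem_range.2
        (Nat.lt_succ_of_le (Finset.le_sup (f := id) hi))⟩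
    refine ⟨N m, by have := hN1 m; omega, ?_⟩
    rw [Finsupp.sum_of_support_subset _ hm _ (by simp), Finset.sum_range]
    refine Submodule.span_mono ?_ (hpow m (fun i => c i))
    rintro _ ⟨k, rfl⟩
    exact ⟨e m k, ⟨⟨m, k⟩, rfl⟩, 1, 1, by simp⟩
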